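/- Let α ∈ (0,1) and let g ∈ W^{1,1}(0,∞) have compact support and satisfy g(0) = 0. Define w₁(x,t) = ∫₀^∞ (ℰ(x−y,t) − ℰ(x+y,t)) g(y) dy and w₂(x,t) = ∫₀^∞ (ℰ(x−y,t) + ℰ(x+y,t)) g(y) dy. Then for each t > 0 and each i ∈ {1,2}: (1) the function x ↦ ∂w_i/∂t (x,t) belongs to L¹(0,∞); (2) the function x ↦ D^α_x w_i (x,t) belongs to L^∞(0,∞); (3) the function x ↦ ∂w_i/∂x (x,t) belongs to L¹(0,∞). -/

import Mathlib

open MeasureTheory Real Set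

/-- Caputo fractional derivative of order `α` on the half-line:
`D^α u(x) = (1/Γ(1−α)) ∫₀ˣ u'(s)(x−s)^{−α} ds`. -/
noncomputable def caputo (α : ℝ) (u : ℝ → ℝ) (x : ℝ) : ℝ :=
  (1 / Real.Gamma (1 - α)) * ∫ s in (0:ℝ)..x, deriv u s * (x - s) ^ (-α)
/-- The function `Φ(x) = Σ (−1)ⁿ bₙ (x^{1+α}/(1+α))ⁿ`, where
`bₙ = ∏_{i<n} Γ(αi+i+2)/Γ(α(i+1)+i+2)`; it equals the generalized Mittag-Leffler
function `E_{α,1+1/α,1/α}(−x^{1+α}/(1+α))`. -/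
noncomputable def PhiF (α : ℝ) (x : ℝ) : ℝ :=
  ∑' n : ℕ, (-1:ℝ)^n *
    (∏ i ∈ Finset.range n, Real.Gamma (α * i + i + 2) / Real.Gamma (α * (i+1) + i + 2)) *
    (x ^ (1+α) / (1+α)) ^ n
/-- The normalizing constant `a₀ = (2∫₀^∞ Φ)⁻¹`. -/
noncomputable def a0 (α : ℝ) : ℝ := (2 * ∫ x in Set.Ioi (0:ℝ), PhiF α x)⁻¹

/-- The fundamental solution `ℰ(x,t) = a₀ t^{−1/(1+α)} Φ(|x| t^{−1/(1+α)})` for `t > 0`,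
extended by `0` for `t ≤ 0`. -/
noncomputable def fundSol (α : ℝ) (x t : ℝ) : ℝ :=
  if 0 < t then a0 α * t ^ (-(1/(1+α))) * PhiF α (|x| * t ^ (-(1/(1+α)))) else 0


/-- The coefficients of `x ^ ((1 + α) n)` in the expansion of `PhiF α`. -/
noncomputable def phiCoeff (α : ℝ) (n : ℕ) : ℝ :=
  (-1) ^ n *
    (∏ i ∈ Finset.range n, Real.Gamma (α * i + i + 2) / Real.Gamma (α * (i + 1) + i + 2)) /
    (1 + α) ^ n

/-- A real power series. -/
noncomputable def powerSum (c : ℕ → ℝ) (z : ℝ) : ℝ := ∑' n : ℕ, c n * z ^ n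

/-- The coefficients of the termwise derivative of a power series. -/
def derivCoeff (c : ℕ → ℝ) (n : ℕ) : ℝ := (n + 1) * c (n + 1)

/-- Coefficients of an everywhere convergent power series. -/
def Entire (c : ℕ → ℝ) : Prop := ∀ r : ℝ, 0 ≤ r → Summable fun n => |c n| * r ^ n

theorem Entire.derivCoeff {c : ℕ → ℝ} (hc : Entire c) : Entire (derivCoeff c) := by
  intro r hr
  have h := (summable_nat_add_iff 1).2 (hc (2 * r + 1) (by positivity))
  refine Summable.of_nonneg_of_le (fun n => by positivity) (fun n => ?_) h
  have h1 : ((n : ℝ) + 1) ≤ 2 ^ n := by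
    exact_mod_cast Nat.lt_two_pow_self (n := n)
  have h2 : (2 * r) ^ n ≤ (2 * r + 1) ^ (n + 1) := by
    calc (2 * r) ^ n ≤ (2 * r + 1) ^ n := by gcongr; linarith
      _ ≤ _ := pow_le_pow_right₀ (by linarith) (by omega)
  have h3 : |_root_.derivCoeff c n| = (n + 1) * |c (n + 1)| := by
    rw [_root_.derivCoeff, abs_mul, abs_of_nonneg (by positivity)]
  rw [h3]
  calc ((n : ℝ) + 1) * |c (n + 1)| * r ^ n ≤ 2 ^ n * |c (n + 1)| * r ^ n := by gcongr
    _ = |c (n + 1)| * (2 * r) ^ n := by rw [mul_pow]; ring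
    _ ≤ _ := by gcongr

theorem Entire.hasDerivAt {c : ℕ → ℝ} (hc : Entire c) (z : ℝ) :
    HasDerivAt (powerSum c) (powerSum (_root_.derivCoeff c) z) z := by
  set R : ℝ := |z| + 1
  have hR : 0 ≤ R := by positivity
  have hs : Summable fun n : ℕ => |c n| * (n * R ^ (n - 1)) := by
    rw [← summable_nat_add_iff 1]
    refine (hc.derivCoeff R hR).congr fun n => ?_
    rw [_root_.derivCoeff, abs_mul, abs_of_nonneg (by positivity : (0 : ℝ) ≤ (n : ℝ) + 1)]
    push_cast
    ring
  have hz : z ∈ Ioo (-R) R := by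
    exact abs_lt.1 (lt_add_one _)
  have hb : ∀ (n : ℕ), ∀ y ∈ Ioo (-R) R, ‖c n * (n * y ^ (n - 1))‖ ≤ |c n| * (n * R ^ (n - 1)) := by
    intro n y hy
    have hy := abs_lt.2 hy
    rw [Real.norm_eq_abs, abs_mul, abs_mul, abs_pow, Nat.abs_cast]
    gcongr
  have h := hasDerivAt_tsum_of_isPreconnected (g := fun n y => c n * y ^ n)
    (g' := fun n y => c n * (n * y ^ (n - 1))) hs isOpen_Ioo isPreconnected_Ioo
    (fun n y _ => (hasDerivAt_pow n y).const_mul (c n)) hb hz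
    ((hc |z| (abs_nonneg z)).of_norm_bounded fun n => by
      rw [Real.norm_eq_abs, abs_mul, abs_pow]) hz
  have hs' : Summable fun n : ℕ => c n * (n * z ^ (n - 1)) :=
    hs.of_norm_bounded fun n => hb n z hz
  refine h.congr_deriv ?_
  rw [hs'.tsum_eq_zero_add, Nat.cast_zero, zero_mul, mul_zero, zero_add]
  refine tsum_congr fun n => ?_
  rw [_root_.derivCoeff]
  push_cast
  ring

theorem Entire.continuous {c : ℕ → ℝ} (hc : Entire c) : Continuous (powerSum c) :=
  continuous_iff_continuousAt.2 fun z => (hc.hasDerivAt z).continuousAt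

theorem Entire.contDiff_one {c : ℕ → ℝ} (hc : Entire c) : ContDiff ℝ 1 (powerSum c) := by
  rw [contDiff_one_iff_deriv]
  refine ⟨fun z => (hc.hasDerivAt z).differentiableAt, ?_⟩
  rw [show deriv (powerSum c) = powerSum (_root_.derivCoeff c) from
    funext fun z => (hc.hasDerivAt z).deriv]
  exact hc.derivCoeff.continuous

theorem Real.rpow_mul_Gamma_le_Gamma_add {α y : ℝ} (hα : 0 < α) (hy : 1 < y) :
    (y - 1) ^ α * Gamma y ≤ Gamma (y + α) := by
  have h := convexOn_log_Gamma.slope_mono_adjacent (x := y - 1) (y := y) (z := y + α)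
    (mem_Ioi.2 (by linarith)) (mem_Ioi.2 (by linarith)) (by linarith) (by linarith)
  have hG : Gamma y = (y - 1) * Gamma (y - 1) := by
    rw [← Gamma_add_one (by linarith), sub_add_cancel]
  have h0 : 0 < Gamma (y - 1) := Gamma_pos_of_pos (by linarith)
  have h1 : 0 < Gamma y := Gamma_pos_of_pos (by linarith)
  have h2 : 0 < Gamma (y + α) := Gamma_pos_of_pos (by linarith)
  have hl : log (Gamma y) = log (y - 1) + log (Gamma (y - 1)) := by
    rw [hG, log_mul (by linarith) h0.ne']
  simp only [Function.comp_apply, sub_sub_cancel, div_one, add_sub_cancel_left] at h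
  rw [le_div_iff₀ hα] at h
  have h3 : 0 < (y - 1) ^ α := rpow_pos_of_pos (by linarith) _
  rw [← log_le_log_iff (by positivity) h2, log_mul h3.ne' h1.ne', log_rpow (by linarith)]
  nlinarith

theorem phiCoeff_succ (α : ℝ) (n : ℕ) :
    phiCoeff α (n + 1) = -(Real.Gamma (α * n + n + 2) / Real.Gamma (α * (n + 1) + n + 2) /
      (1 + α)) * phiCoeff α n := by
  rw [phiCoeff, phiCoeff, Finset.prod_range_succ, pow_succ, pow_succ]
  generalize 1 + α = b
  ring

theorem phiCoeff_ne_zero {α : ℝ} (hα : 0 < α) (n : ℕ) : phiCoeff α n ≠ 0 := by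
  induction n with
  | zero => simp [phiCoeff]
  | succ n ih =>
    rw [phiCoeff_succ]
    have h1 := Real.Gamma_pos_of_pos (s := α * n + n + 2) (by positivity)
    have h2 := Real.Gamma_pos_of_pos (s := α * (n + 1) + n + 2) (by positivity)
    exact mul_ne_zero (neg_ne_zero.2 (by positivity)) ih

theorem entire_phiCoeff {α : ℝ} (hα : 0 < α) : Entire (phiCoeff α) := by
  intro r hr
  rcases hr.eq_or_lt with rfl | hr
  · refine summable_of_ne_finset_zero (s := {0}) fun n hn => ?_
    rw [zero_pow (by simpa using hn), mul_zero]
  refine summable_of_ratio_test_tendsto_lt_one (l := 0) zero_lt_one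
    (Filter.Eventually.of_forall fun n => by
      have := phiCoeff_ne_zero hα n
      positivity) ?_
  have hlim : Filter.Tendsto (fun n : ℕ => r * ((n : ℝ) ^ α)⁻¹) Filter.atTop (nhds 0) := by
    have := ((tendsto_rpow_atTop hα).comp tendsto_natCast_atTop_atTop).inv_tendsto_atTop
    simpa using this.const_mul r
  refine squeeze_zero' (Filter.Eventually.of_forall fun n => by positivity) ?_ hlim
  filter_upwards [Filter.eventually_gt_atTop 0] with n hn
  have hn' : (0 : ℝ) < n := by exact_mod_cast hn
  have hc := abs_pos.2 (phiCoeff_ne_zero hα n)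
  have h1 := Real.Gamma_pos_of_pos (s := α * n + n + 2) (by positivity)
  have h2 := Real.Gamma_pos_of_pos (s := α * (n + 1) + n + 2) (by positivity)
  have h3 := Real.rpow_mul_Gamma_le_Gamma_add (y := α * n + n + 2) hα (by nlinarith)
  rw [show α * n + n + 2 + α = α * (n + 1) + n + 2 by ring] at h3
  have h4 : (n : ℝ) ^ α ≤ (α * n + n + 2 - 1) ^ α :=
    Real.rpow_le_rpow hn'.le (by nlinarith) hα.le
  have h5 : 0 < (n : ℝ) ^ α := Real.rpow_pos_of_pos hn' _
  rw [Real.norm_of_nonneg (by positivity), Real.norm_of_nonneg (by positivity), phiCoeff_succ,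
    abs_mul, abs_neg, abs_of_pos (by positivity), pow_succ]
  have h6 : Real.Gamma (α * n + n + 2) / Real.Gamma (α * (n + 1) + n + 2) / (1 + α) ≤
      ((n : ℝ) ^ α)⁻¹ := by
    rw [div_div, div_le_iff₀ (by positivity), ← div_eq_inv_mul, le_div_iff₀ h5]
    nlinarith [mul_le_mul_of_nonneg_right h4 h1.le]
  rw [div_le_iff₀ (by positivity)]
  calc _ ≤ ((n : ℝ) ^ α)⁻¹ * |phiCoeff α n| * (r ^ n * r) := by gcongr
    _ = _ := by ring

theorem integral_rpow_mul_sub_rpow {p q x : ℝ} (hp : 0 < p) (hq : 0 < q) (hx : 0 < x) :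
    ∫ s in (0 : ℝ)..x, s ^ (p - 1) * (x - s) ^ (q - 1) =
      Gamma p * Gamma q / Gamma (p + q) * x ^ (p + q - 1) := by
  have hΓ : (Gamma (p + q) : ℂ) ≠ 0 := by
    exact_mod_cast (Gamma_pos_of_pos (by linarith)).ne'
  have hB := Complex.Gamma_mul_Gamma_eq_betaIntegral (s := p) (t := q) (by simpa) (by simpa)
  have hs := Complex.betaIntegral_scaled p q hx
  apply Complex.ofReal_injective
  rw [← intervalIntegral.integral_ofReal]
  have hcongr : ∫ s in (0 : ℝ)..x, ((s ^ (p - 1) * (x - s) ^ (q - 1) : ℝ) : ℂ) =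
      ∫ s in (0 : ℝ)..x, (s : ℂ) ^ ((p : ℂ) - 1) * ((x : ℂ) - s) ^ ((q : ℂ) - 1) := by
    refine intervalIntegral.integral_congr fun s hs => ?_
    rw [uIcc_of_le hx.le] at hs
    push_cast
    rw [Complex.ofReal_cpow hs.1, Complex.ofReal_cpow (sub_nonneg.2 hs.2)]
    push_cast
    rfl
  rw [hcongr, hs, Complex.ofReal_mul, Complex.ofReal_cpow hx.le]
  push_cast
  rw [← Complex.ofReal_add, Complex.Gamma_ofReal, Complex.Gamma_ofReal, Complex.Gamma_ofReal] at hB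
  rw [hB]
  field_simp

theorem intervalIntegrable_rpow_mul_sub_rpow {p q x : ℝ} (hp : 0 < p) (hq : 0 < q) (hx : 0 < x) :
    IntervalIntegrable (fun s => s ^ (p - 1) * (x - s) ^ (q - 1)) volume 0 x := by
  refine intervalIntegral.intervalIntegrable_of_integral_ne_zero ?_
  rw [integral_rpow_mul_sub_rpow hp hq hx]
  have h1 := Gamma_pos_of_pos hp
  have h2 := Gamma_pos_of_pos hq
  have h3 := Gamma_pos_of_pos (add_pos hp hq)
  positivity

theorem PhiF_eq_powerSum (α x : ℝ) : PhiF α x = powerSum (phiCoeff α) (x ^ (1 + α)) := by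
  refine tsum_congr fun n => ?_
  rw [phiCoeff, div_pow]
  ring

/-- The derivative of `PhiF α`. -/
noncomputable def phiDeriv (α x : ℝ) : ℝ :=
  powerSum (derivCoeff (phiCoeff α)) (x ^ (1 + α)) * ((1 + α) * x ^ α)

theorem hasDerivAt_PhiF {α : ℝ} (hα : 0 < α) (x : ℝ) : HasDerivAt (PhiF α) (phiDeriv α x) x := by
  have h := ((entire_phiCoeff hα).hasDerivAt (x ^ (1 + α))).comp x
    (hasDerivAt_rpow_const (x := x) (p := 1 + α) (Or.inr (by linarith)))
  rw [add_sub_cancel_left] at h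
  exact h.congr_of_eventuallyEq (Filter.Eventually.of_forall fun y => PhiF_eq_powerSum α y)

theorem continuous_PhiF {α : ℝ} (hα : 0 < α) : Continuous (PhiF α) :=
  continuous_iff_continuousAt.2 fun x => (hasDerivAt_PhiF hα x).continuousAt

theorem continuous_phiDeriv {α : ℝ} (hα : 0 < α) : Continuous (phiDeriv α) :=
  ((entire_phiCoeff hα).derivCoeff.continuous.comp
    (continuous_rpow_const (by linarith))).mul
    (continuous_const.mul (continuous_rpow_const hα.le))

theorem PhiF_zero {α : ℝ} (hα : 0 < α) : PhiF α 0 = 1 := by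
  rw [PhiF_eq_powerSum, zero_rpow (by linarith), powerSum, tsum_eq_single 0]
  · simp [phiCoeff]
  · intro n hn
    rw [zero_pow hn, mul_zero]

theorem intervalIntegrable_sub_rpow_neg {α : ℝ} (hα1 : α < 1) (a b x : ℝ) :
    IntervalIntegrable (fun s => (x - s) ^ (-α)) volume a b := by
  have h := (intervalIntegral.intervalIntegrable_rpow' (r := -α) (a := x - a) (b := x - b)
    (by linarith)).comp_sub_left x
  simpa using h

/-- The self-similar equation `D^α Φ(x) = -x Φ(x) / (1 + α)`. -/
theorem integral_phiDeriv_mul_sub_rpow {α x : ℝ} (hα : 0 < α) (hα1 : α < 1) (hx : 0 < x) :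
    ∫ s in (0 : ℝ)..x, phiDeriv α s * (x - s) ^ (-α) =
      -(Gamma (1 - α) / (1 + α) * (x * PhiF α x)) := by
  have hq : 0 < 1 - α := by linarith
  have hGq := Gamma_pos_of_pos hq
  set F : ℕ → ℝ → ℝ := fun n s => ((1 + α) * derivCoeff (phiCoeff α) n) *
    (s ^ ((1 + α) * (n + 1) - 1) * (x - s) ^ (1 - α - 1))
  have hp : ∀ n : ℕ, 0 < (1 + α) * (n + 1) := fun n => by positivity
  have hint : ∀ n, IntervalIntegrable (F n) volume 0 x := fun n =>
    (intervalIntegrable_rpow_mul_sub_rpow (hp n) hq hx).const_mul _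
  set v : ℕ → ℝ := fun n => -(Gamma (1 - α) / (1 + α) * x) * (phiCoeff α n * (x ^ (1 + α)) ^ n)
  have hF : ∀ n, ∫ s in (0 : ℝ)..x, F n s = v n := by
    intro n
    have h1 := Gamma_pos_of_pos (s := α * n + n + 2) (by positivity)
    have h2 := Gamma_pos_of_pos (s := α * (n + 1) + n + 2) (by positivity)
    have hΓ : Gamma (α * (n + 1) + n + 2) =
        (1 + α) * (n + 1) * Gamma ((1 + α) * (n + 1)) := by
      rw [← Gamma_add_one (hp n).ne']
      ring_nf
    have hpow : x ^ ((1 + α) * (n + 1) + (1 - α) - 1) = x * (x ^ (1 + α)) ^ n := by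
      rw [← rpow_mul_natCast hx.le, ← rpow_one_add' hx.le (by positivity)]
      ring_nf
    rw [intervalIntegral.integral_const_mul, integral_rpow_mul_sub_rpow (hp n) hq hx, hpow,
      derivCoeff, phiCoeff_succ,
      show (1 + α) * ((n : ℝ) + 1) + (1 - α) = α * n + n + 2 by ring]
    have hg := Gamma_pos_of_pos (hp n)
    simp only [v]
    rw [hΓ]
    field_simp
  have hFabs : ∀ n, ∫ s in Ioc 0 x, ‖F n s‖ = |v n| := by
    intro n
    have habs : ∀ s ∈ Ioc 0 x, ‖F n s‖ = |(1 + α) * derivCoeff (phiCoeff α) n| *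
        (s ^ ((1 + α) * (n + 1) - 1) * (x - s) ^ (1 - α - 1)) := by
      intro s hs
      rw [Real.norm_eq_abs, abs_mul, abs_of_nonneg (a := s ^ _ * _)
        (mul_nonneg (rpow_nonneg hs.1.le _) (rpow_nonneg (sub_nonneg.2 hs.2) _))]
    have hnn : 0 ≤ ∫ s in Ioc 0 x, s ^ ((1 + α) * (n + 1) - 1) * (x - s) ^ (1 - α - 1) :=
      setIntegral_nonneg measurableSet_Ioc fun s hs =>
        mul_nonneg (rpow_nonneg hs.1.le _) (rpow_nonneg (sub_nonneg.2 hs.2) _)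
    rw [setIntegral_congr_fun measurableSet_Ioc habs, integral_const_mul, ← hF n,
      intervalIntegral.integral_of_le hx.le, integral_const_mul, abs_mul (_ * _), abs_of_nonneg hnn]
  have hsum : Summable fun n => |v n| := by
    have := (entire_phiCoeff hα (x ^ (1 + α)) (by positivity)).mul_left
      |-(Gamma (1 - α) / (1 + α) * x)|
    refine this.congr fun n => ?_
    simp only [v]
    rw [abs_mul, abs_mul (phiCoeff α n), abs_of_nonneg (a := (x ^ (1 + α)) ^ n) (by positivity)]
  have key := hasSum_integral_of_summable_integral_norm (μ := volume.restrict (Ioc 0 x)) (F := F)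
    (fun n => (hint n).1) (hsum.congr fun n => (hFabs n).symm)
  have hpt : ∀ s ∈ Ioc 0 x, ∑' n, F n s = phiDeriv α s * (x - s) ^ (-α) := by
    intro s hs
    rw [phiDeriv, powerSum, ← tsum_mul_right, ← tsum_mul_right]
    refine tsum_congr fun n => ?_
    have hpow : s ^ ((1 + α) * (n + 1) - 1) = s ^ α * (s ^ (1 + α)) ^ n := by
      rw [← rpow_mul_natCast hs.1.le, ← rpow_add hs.1]
      ring_nf
    simp only [F]
    rw [hpow, show 1 - α - 1 = -α by ring]
    ring
  rw [intervalIntegral.integral_of_le hx.le, ← setIntegral_congr_fun measurableSet_Ioc hpt,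
    ← key.tsum_eq]
  simp_rw [← intervalIntegral.integral_of_le hx.le, hF, v]
  rw [tsum_mul_left, PhiF_eq_powerSum, powerSum]
  ring

theorem pos_of_no_first_zero {f : ℝ → ℝ} (hf : Continuous f) (h0 : 0 < f 0)
    (h : ∀ X > 0, f X = 0 → (∀ s ∈ Ico 0 X, 0 < f s) → False) {x : ℝ} (hx : 0 ≤ x) : 0 < f x := by
  by_contra! hneg
  set S : Set ℝ := Ici 0 ∩ {y | f y ≤ 0}
  have hS : IsClosed S := isClosed_Ici.inter (isClosed_le hf continuous_const)
  have hbdd : BddBelow S := ⟨0, fun y hy => hy.1⟩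
  have hmem : sInf S ∈ S := hS.csInf_mem ⟨x, hx, hneg⟩ hbdd
  have hlt : ∀ s ∈ Ico 0 (sInf S), 0 < f s := fun s hs => by
    by_contra! hle
    exact absurd (csInf_le hbdd ⟨hs.1, hle⟩) (not_le.2 hs.2)
  have hpos : 0 < sInf S := by
    refine lt_of_le_of_ne hmem.1 fun heq => ?_
    have : f (sInf S) ≤ 0 := hmem.2
    rw [← heq] at this
    linarith
  refine h _ hpos (le_antisymm hmem.2 ?_) hlt
  refine ge_of_tendsto (hf.continuousWithinAt (s := Iio (sInf S)) (x := sInf S)) ?_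
  filter_upwards [Ioo_mem_nhdsLT hpos] with s hs using (hlt s ⟨hs.1.le, hs.2⟩).le

theorem exists_abs_le_mul_sub_of_hasDerivAt {v : ℝ → ℝ} {v' X : ℝ}
    (hv : HasDerivAt v v' X) (hX : v X = 0) :
    ∃ M > 0, ∃ a < X, ∀ s ∈ Ioo a X, |v s| ≤ M * (X - s) := by
  obtain ⟨M, hM, hb⟩ := hv.isBigO_sub.exists_pos
  obtain ⟨a, ha, hs⟩ := mem_nhdsLT_iff_exists_Ioo_subset.1
    (hb.bound.filter_mono (nhdsWithin_le_nhds (s := Iio X)))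
  refine ⟨M, hM, a, ha, fun s hs' => ?_⟩
  have h : ‖v s - v X‖ ≤ M * ‖s - X‖ := hs hs'
  rwa [hX, sub_zero, Real.norm_eq_abs, Real.norm_eq_abs, abs_sub_comm,
    abs_of_pos (sub_pos.2 hs'.2)] at h

theorem tendsto_const_mul_sub_rpow_nhdsLT {β : ℝ} (hβ : 0 < β) (M X : ℝ) :
    Filter.Tendsto (fun s => M * (X - s) ^ β) (nhdsWithin X (Iio X)) (nhds 0) := by
  have hc : Continuous fun s : ℝ => M * (X - s) ^ β :=
    continuous_const.mul ((continuous_rpow_const hβ.le).comp (continuous_const.sub continuous_id))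
  have := hc.continuousWithinAt (s := Iio X) (x := X)
  rw [ContinuousWithinAt, sub_self, zero_rpow hβ.ne', mul_zero] at this
  exact this

/-- A maximum principle for the Caputo derivative at a zero which is a minimum. -/
theorem integral_deriv_mul_sub_rpow_le_of_first_zero {α X : ℝ} {f f' : ℝ → ℝ} (hα : 0 < α)
    (hα1 : α < 1) (hX : 0 < X) (hf : ∀ s, HasDerivAt f (f' s) s) (hf' : Continuous f')
    (hnn : ∀ s ∈ Ico 0 X, 0 < f s) (hfX : f X = 0) :
    ∫ s in (0 : ℝ)..X, f' s * (X - s) ^ (-α) ≤ -(f 0 * X ^ (-α)) := by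
  obtain ⟨M, -, a, haX, hM⟩ := exists_abs_le_mul_sub_of_hasDerivAt (hf X) hfX
  have hint : ∀ b c, IntervalIntegrable (fun s => f' s * (X - s) ^ (-α)) volume b c := fun b c =>
    (intervalIntegrable_sub_rpow_neg hα1 b c X).continuousOn_mul hf'.continuousOn
  have hlim : Filter.Tendsto (fun b => ∫ s in (0 : ℝ)..b, f' s * (X - s) ^ (-α))
      (nhdsWithin X (Iio X)) (nhds (∫ s in (0 : ℝ)..X, f' s * (X - s) ^ (-α))) :=
    (intervalIntegral.continuous_primitive hint 0).continuousWithinAt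
  have hlim2 := (tendsto_const_mul_sub_rpow_nhdsLT (β := 1 - α) (by linarith) M X).sub_const
    (f 0 * X ^ (-α))
  rw [zero_sub] at hlim2
  refine le_of_tendsto_of_tendsto hlim hlim2 ?_
  filter_upwards [Ioo_mem_nhdsLT hX, Ioo_mem_nhdsLT haX] with b hb hb'
  have hbX : 0 < X - b := sub_pos.2 hb.2
  have hder : ∀ s ∈ uIcc 0 b, HasDerivAt (fun s => (X - s) ^ (-α))
      (α * (X - s) ^ (-α - 1)) s := by
    intro s hs
    rw [uIcc_of_le hb.1.le] at hs
    have hpos : X - s ≠ 0 := by linarith [hs.2]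
    have := ((hasDerivAt_id s).const_sub X).rpow_const (p := -α) (Or.inl hpos)
    refine this.congr_deriv ?_
    simp
  have hcont : ContinuousOn (fun s => α * (X - s) ^ (-α - 1)) (uIcc 0 b) := by
    rw [uIcc_of_le hb.1.le]
    refine continuousOn_const.mul ((continuousOn_const.sub continuousOn_id).rpow_const
      fun s hs => Or.inl (sub_pos.2 (hs.2.trans_lt hb.2)).ne')
  have hparts := intervalIntegral.integral_mul_deriv_eq_deriv_mul (a := 0) (b := b)
    (u := f) (v := fun s => (X - s) ^ (-α)) (fun s _ => hf s) hder
    (hf'.intervalIntegrable _ _) hcont.intervalIntegrable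
  have hnonneg : 0 ≤ ∫ s in (0 : ℝ)..b, f s * (α * (X - s) ^ (-α - 1)) := by
    refine intervalIntegral.integral_nonneg hb.1.le fun s hs => ?_
    have h1 := hnn s ⟨hs.1, hs.2.trans_lt hb.2⟩
    have h2 : 0 ≤ X - s := by linarith [hs.2]
    positivity
  have hfb : f b * (X - b) ^ (-α) ≤ M * (X - b) ^ (1 - α) := by
    have h1 := (le_abs_self _).trans (hM b hb')
    have h2 : (X - b) ^ (1 - α) = (X - b) * (X - b) ^ (-α) := by
      rw [sub_eq_add_neg 1 α, rpow_add hbX, rpow_one]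
    rw [h2, ← mul_assoc]
    gcongr
  rw [sub_zero] at hparts
  linarith

/-- A maximum principle for the Riemann–Liouville derivative at a zero which is a minimum. -/
theorem deriv_integral_mul_sub_rpow_nonpos_of_first_zero {α X v' d : ℝ} {v h : ℝ → ℝ} (hα : 0 < α)
    (hα1 : α < 1) (hX : 0 < X) (hvc : Continuous v) (hv : HasDerivAt v v' X)
    (hnn : ∀ s ∈ Ico 0 X, 0 ≤ v s) (hvX : v X = 0)
    (hh : ∀ x > 0, ∫ s in (0 : ℝ)..x, v s * (x - s) ^ (-α) = h x) (hd : HasDerivAt h d X) :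
    d ≤ 0 := by
  obtain ⟨M, hM0, a, haX, hM⟩ := exists_abs_le_mul_sub_of_hasDerivAt hv hvX
  have hint : ∀ x b c, IntervalIntegrable (fun s => v s * (x - s) ^ (-α)) volume b c :=
    fun x b c => (intervalIntegrable_sub_rpow_neg hα1 b c x).continuousOn_mul hvc.continuousOn
  have hslope : Filter.Tendsto (slope h X) (nhdsWithin X (Iio X)) (nhds d) :=
    (hasDerivAt_iff_tendsto_slope.1 hd).mono_left (nhdsWithin_mono _ fun s hs => ne_of_lt hs)
  refine le_of_tendsto_of_tendsto hslope
    (tendsto_const_mul_sub_rpow_nhdsLT (β := 1 - α) (by linarith) M X) ?_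
  filter_upwards [Ioo_mem_nhdsLT hX, Ioo_mem_nhdsLT haX] with x hx hx'
  have hxX : 0 < X - x := sub_pos.2 hx.2
  have h1 : ∫ s in (0 : ℝ)..x, v s * (X - s) ^ (-α) ≤ h x := by
    rw [← hh x hx.1]
    refine intervalIntegral.integral_mono_on_of_le_Ioo hx.1.le (hint X 0 x) (hint x 0 x)
      fun s hs => ?_
    refine mul_le_mul_of_nonneg_left ?_ (hnn s ⟨hs.1.le, hs.2.trans hx.2⟩)
    exact rpow_le_rpow_of_nonpos (sub_pos.2 hs.2) (by linarith) (by linarith)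
  have h2 : ∫ s in x..X, v s * (X - s) ^ (-α) ≤ M * (X - x) ^ (1 - α) * (X - x) := by
    have hconst : ∫ _ in x..X, M * (X - x) ^ (1 - α) = M * (X - x) ^ (1 - α) * (X - x) := by
      rw [intervalIntegral.integral_const, smul_eq_mul, mul_comm]
    rw [← hconst]
    refine intervalIntegral.integral_mono_on_of_le_Ioo hx.2.le (hint X x X)
      intervalIntegrable_const fun s hs => ?_
    have hs0 : 0 < X - s := sub_pos.2 hs.2
    have h3 := (le_abs_self _).trans (hM s ⟨hx'.1.trans hs.1, hs.2⟩)
    have h4 : (X - s) ^ (1 - α) = (X - s) * (X - s) ^ (-α) := by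
      rw [sub_eq_add_neg 1 α, rpow_add hs0, rpow_one]
    calc v s * (X - s) ^ (-α) ≤ M * (X - s) * (X - s) ^ (-α) := by gcongr
      _ = M * (X - s) ^ (1 - α) := by rw [h4, mul_assoc]
      _ ≤ M * (X - x) ^ (1 - α) := by
        have := hs.1
        gcongr
  have h3 := intervalIntegral.integral_add_adjacent_intervals (hint X 0 x) (hint X x X)
  rw [hh X hX] at h3
  rw [slope_comm, slope_def_field, div_le_iff₀ hxX]
  linarith

theorem PhiF_pos {α x : ℝ} (hα : 0 < α) (hα1 : α < 1) (hx : 0 ≤ x) : 0 < PhiF α x := by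
  refine pos_of_no_first_zero (continuous_PhiF hα) (by simp [PhiF_zero hα])
    (fun X hX hzero hpos => ?_) hx
  have h := integral_deriv_mul_sub_rpow_le_of_first_zero hα hα1 hX (hasDerivAt_PhiF hα)
    (continuous_phiDeriv hα) hpos hzero
  rw [integral_phiDeriv_mul_sub_rpow hα hα1 hX, hzero, PhiF_zero hα] at h
  have := rpow_pos_of_pos hX (-α)
  simp only [mul_zero, neg_zero, one_mul] at h
  linarith

theorem phiDeriv_nonpos {α x : ℝ} (hα : 0 < α) (hα1 : α < 1) (hx : 0 ≤ x) : phiDeriv α x ≤ 0 := by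
  have hE := (entire_phiCoeff hα).derivCoeff
  have hE0 : powerSum (derivCoeff (phiCoeff α)) 0 < 0 := by
    rw [powerSum, tsum_eq_single 0 fun n hn => by rw [zero_pow hn, mul_zero]]
    have h1 := Gamma_pos_of_pos (s := α + 2) (by linarith)
    have h2 : 0 < (Gamma (α + 2))⁻¹ / (1 + α) := by positivity
    simpa [derivCoeff, phiCoeff, neg_div] using h2
  have key : ∀ z : ℝ, 0 ≤ z → 0 < -powerSum (derivCoeff (phiCoeff α)) z := fun z hz => by
    refine pos_of_no_first_zero hE.continuous.neg (neg_pos.2 hE0) (fun Z hZ hzero hpos => ?_) hz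
    have hα' : 1 + α ≠ 0 := by linarith
    set X := Z ^ (1 + α)⁻¹
    have hX : 0 < X := rpow_pos_of_pos hZ _
    have hXZ : X ^ (1 + α) = Z := rpow_inv_rpow hZ.le hα'
    have hphi : phiDeriv α X = 0 := by
      rw [phiDeriv, hXZ, neg_eq_zero.1 hzero, zero_mul]
    have hnn : ∀ s ∈ Ico 0 X, 0 ≤ -phiDeriv α s := by
      intro s hs
      have h1 := hpos (s ^ (1 + α)) ⟨rpow_nonneg hs.1 _, by
        rw [← hXZ]
        exact rpow_lt_rpow hs.1 hs.2 (by linarith)⟩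
      have h2 : 0 ≤ (1 + α) * s ^ α := mul_nonneg (by linarith) (rpow_nonneg hs.1 _)
      rw [phiDeriv, ← neg_mul]
      exact mul_nonneg h1.le h2
    have hderiv : DifferentiableAt ℝ (phiDeriv α) X :=
      ((hE.hasDerivAt _).comp X
        (hasDerivAt_rpow_const (p := 1 + α) (Or.inl hX.ne'))).differentiableAt.mul
        ((hasDerivAt_rpow_const (p := α) (Or.inl hX.ne')).differentiableAt.const_mul _)
    have hG := Gamma_pos_of_pos (s := 1 - α) (by linarith)
    have hle := deriv_integral_mul_sub_rpow_nonpos_of_first_zero (v := fun s => -phiDeriv α s)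
      (h := fun x => Gamma (1 - α) / (1 + α) * (x * PhiF α x)) hα hα1 hX
      (continuous_phiDeriv hα).neg hderiv.hasDerivAt.neg hnn (by rw [hphi, neg_zero])
      (fun x hx => by
        simp_rw [neg_mul]
        rw [intervalIntegral.integral_neg, integral_phiDeriv_mul_sub_rpow hα hα1 hx, neg_neg])
      (((hasDerivAt_id X).mul (hasDerivAt_PhiF hα X)).const_mul _)
    have hP := PhiF_pos hα hα1 hX.le
    rw [hphi, mul_zero, add_zero, one_mul] at hle
    have : 0 < Gamma (1 - α) / (1 + α) * PhiF α X := by positivity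
    linarith
  have h1 := key (x ^ (1 + α)) (rpow_nonneg hx _)
  have h2 : 0 ≤ (1 + α) * x ^ α := mul_nonneg (by linarith) (rpow_nonneg hx _)
  rw [phiDeriv]
  exact mul_nonpos_of_nonpos_of_nonneg (by linarith) h2

theorem integrableOn_mul_phiDeriv {α : ℝ} (hα : 0 < α) (hα1 : α < 1)
    (hint : IntegrableOn (PhiF α) (Ioi 0)) :
    IntegrableOn (fun x => x * phiDeriv α x) (Ioi 0) := by
  have hc : Continuous fun x => x * phiDeriv α x := continuous_id.mul (continuous_phiDeriv hα)
  refine integrableOn_Ioi_of_intervalIntegral_norm_bounded (b := id) (l := Filter.atTop)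
    (∫ x in Ioi 0, PhiF α x) 0 (fun b => hc.integrableOn_Ioc) Filter.tendsto_id ?_
  filter_upwards [Filter.eventually_gt_atTop 0] with X hX
  have hnorm : ∫ x in (0 : ℝ)..X, ‖x * phiDeriv α x‖ =
      -∫ x in (0 : ℝ)..X, x * phiDeriv α x := by
    rw [← intervalIntegral.integral_neg]
    refine intervalIntegral.integral_congr fun x hx => ?_
    rw [uIcc_of_le hX.le] at hx
    rw [Real.norm_eq_abs, abs_of_nonpos
      (mul_nonpos_of_nonneg_of_nonpos hx.1 (phiDeriv_nonpos hα hα1 hx.1))]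
  have hparts := intervalIntegral.integral_mul_deriv_eq_deriv_mul (a := 0) (b := X)
    (u := fun x => x) (v := PhiF α) (fun x _ => hasDerivAt_id' x)
    (fun x _ => hasDerivAt_PhiF hα x) intervalIntegrable_const
    ((continuous_phiDeriv hα).intervalIntegrable _ _)
  simp only [id, one_mul, zero_mul, sub_zero] at hparts ⊢
  rw [hnorm, hparts]
  have h1 : ∫ x in (0 : ℝ)..X, PhiF α x ≤ ∫ x in Ioi 0, PhiF α x := by
    rw [intervalIntegral.integral_of_le hX.le]
    refine setIntegral_mono_set hint ?_ (Filter.Eventually.of_forall Ioc_subset_Ioi_self)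
    filter_upwards [ae_restrict_mem measurableSet_Ioi] with x hx
      using (PhiF_pos hα hα1 (le_of_lt hx)).le
  have h2 := mul_pos hX (PhiF_pos hα hα1 hX.le)
  linarith

theorem integrable_comp_abs_of_integrableOn_Ioi {f : ℝ → ℝ} (hf : IntegrableOn f (Ioi 0)) :
    Integrable fun x => f |x| := by
  have hneg : IntegrableOn (fun x => f |x|) (Iio 0) := by
    have h := hf.comp_neg
    rw [neg_Ioi, neg_zero] at h
    refine h.congr_fun (fun x hx => ?_) measurableSet_Iio
    simp only [abs_of_neg (mem_Iio.1 hx)]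
  have hpos : IntegrableOn (fun x => f |x|) (Ioi 0) :=
    hf.congr_fun (fun x hx => by simp only [abs_of_pos (mem_Ioi.1 hx)]) measurableSet_Ioi
  rw [← integrableOn_univ, ← Iic_union_Ioi (a := (0 : ℝ)), integrableOn_union]
  exact ⟨(integrableOn_Iic_iff_integrableOn_Iio (by simp)).2 hneg, hpos⟩

theorem integrable_of_integrable_mul_self {f : ℝ → ℝ} (hf : Continuous f)
    (hxf : Integrable fun x => x * f x) : Integrable f := by
  have hloc : Integrable ((Icc (-1 : ℝ) 1).indicator fun x => ‖f x‖) :=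
    (integrable_indicator_iff measurableSet_Icc).2 hf.norm.integrableOn_Icc
  refine (hxf.norm.add hloc).mono' hf.aestronglyMeasurable
    (Filter.Eventually.of_forall fun x => ?_)
  simp only [Pi.add_apply]
  by_cases hx : x ∈ Icc (-1 : ℝ) 1
  · rw [indicator_of_mem hx]
    linarith [norm_nonneg (x * f x)]
  · rw [indicator_of_notMem hx, add_zero, norm_mul]
    have h1 : 1 ≤ ‖x‖ := by
      by_contra! hlt
      exact hx (abs_le.1 hlt.le)
    nlinarith [norm_nonneg (f x)]

/-- The derivative of the even extension `x ↦ PhiF α |x|`. -/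
noncomputable def evenPhiDeriv (α x : ℝ) : ℝ :=
  powerSum (derivCoeff (phiCoeff α)) (|x| ^ (1 + α)) * ((1 + α) * |x| ^ (1 + α - 2) * x)

theorem hasDerivAt_PhiF_abs {α : ℝ} (hα : 0 < α) (x : ℝ) :
    HasDerivAt (fun x => PhiF α |x|) (evenPhiDeriv α x) x :=
  (((entire_phiCoeff hα).hasDerivAt _).comp x
    (hasDerivAt_abs_rpow x (p := 1 + α) (by linarith))).congr_of_eventuallyEq
    (Filter.Eventually.of_forall fun y => PhiF_eq_powerSum α |y|)

theorem continuous_evenPhiDeriv {α : ℝ} (hα : 0 < α) : Continuous (evenPhiDeriv α) := by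
  have h : ContDiff ℝ 1 fun x : ℝ => PhiF α |x| := by
    simp_rw [PhiF_eq_powerSum]
    exact (entire_phiCoeff hα).contDiff_one.comp (contDiff_norm_rpow (E := ℝ) (by linarith))
  have h' := (contDiff_one_iff_deriv.1 h).2
  rwa [show deriv (fun x : ℝ => PhiF α |x|) = evenPhiDeriv α from
    funext fun x => (hasDerivAt_PhiF_abs hα x).deriv] at h'

theorem abs_evenPhiDeriv {α : ℝ} (hα : 0 < α) (x : ℝ) :
    |evenPhiDeriv α x| = |phiDeriv α (|x|)| := by
  rcases eq_or_ne x 0 with rfl | hx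
  · simp [evenPhiDeriv, phiDeriv, zero_rpow hα.ne']
  · have hx' := abs_pos.2 hx
    rw [evenPhiDeriv, phiDeriv, abs_mul, abs_mul, abs_mul, abs_mul, abs_mul, mul_assoc,
      abs_of_nonneg (rpow_nonneg hx'.le _), abs_of_nonneg (rpow_nonneg hx'.le _)]
    congr 2
    rw [← rpow_add_one hx'.ne']
    ring_nf

theorem integrable_mul_evenPhiDeriv {α : ℝ} (hα : 0 < α) (hα1 : α < 1)
    (hint : IntegrableOn (PhiF α) (Ioi 0)) : Integrable fun x => x * evenPhiDeriv α x := by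
  refine (integrable_comp_abs_of_integrableOn_Ioi (integrableOn_mul_phiDeriv hα hα1 hint)).mono
    (continuous_id.mul (continuous_evenPhiDeriv hα)).aestronglyMeasurable
    (Filter.Eventually.of_forall fun x => ?_)
  rw [norm_mul, norm_mul, Real.norm_eq_abs, Real.norm_eq_abs, Real.norm_eq_abs, Real.norm_eq_abs,
    abs_abs, abs_evenPhiDeriv hα]

theorem Continuous.integrable_mul_of_hasCompactSupport {f G : ℝ → ℝ} (hf : Continuous f)
    (hG : Integrable G) (hGc : HasCompactSupport G) : Integrable fun y => f y * G y := by
  obtain ⟨C, hC⟩ := hGc.isCompact.exists_bound_of_continuousOn hf.continuousOn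
  refine (hG.norm.const_mul C).mono' (hf.aestronglyMeasurable.mul hG.1)
    (Filter.Eventually.of_forall fun y => ?_)
  rw [norm_mul]
  by_cases hy : y ∈ tsupport G
  · gcongr
    exact hC y hy
  · simp [image_eq_zero_of_notMem_tsupport hy]

theorem hasDerivAt_integral_mul_of_hasCompactSupport {f f' : ℝ → ℝ → ℝ} {G : ℝ → ℝ}
    (hf : ∀ s y, HasDerivAt (fun s => f s y) (f' s y) s) (hfc : ∀ s, Continuous (f s))
    (hf'c : Continuous (Function.uncurry f')) (hG : Integrable G) (hGc : HasCompactSupport G)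
    (s : ℝ) : HasDerivAt (fun s => ∫ y, f s y * G y) (∫ y, f' s y * G y) s := by
  obtain ⟨C, hC⟩ := ((isCompact_Icc (a := s - 1) (b := s + 1)).prod
    hGc.isCompact).exists_bound_of_continuousOn hf'c.continuousOn
  have hmem : Ioo (s - 1) (s + 1) ∈ nhds s := Ioo_mem_nhds (by linarith) (by linarith)
  refine (hasDerivAt_integral_of_dominated_loc_of_deriv_le (bound := fun y => C * ‖G y‖) hmem
    (Filter.Eventually.of_forall fun r => (hfc r).aestronglyMeasurable.mul hG.1)
    ((hfc s).integrable_mul_of_hasCompactSupport hG hGc)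
    ((hf'c.comp (Continuous.prodMk_right s)).aestronglyMeasurable.mul hG.1)
    (Filter.Eventually.of_forall fun y r hr => ?_) (hG.norm.const_mul C)
    (Filter.Eventually.of_forall fun y r _ => (hf r y).mul_const (G y))).2
  rw [norm_mul]
  by_cases hy : y ∈ tsupport G
  · gcongr
    exact hC (r, y) ⟨Ioo_subset_Icc_self hr, hy⟩
  · simp [image_eq_zero_of_notMem_tsupport hy]

theorem integrable_integral_sub_mul {H G : ℝ → ℝ} (hH : Integrable H) (hG : Integrable G) :
    Integrable fun x => ∫ y, H (x - y) * G y := by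
  have h := hG.integrable_convolution (ContinuousLinearMap.mul ℝ ℝ) hH
  refine h.congr (Filter.Eventually.of_forall fun x => ?_)
  simp only [convolution_def, ContinuousLinearMap.mul_apply', mul_comm]

theorem abs_integral_sub_mul_le {H G : ℝ → ℝ} {C : ℝ} (hH : Integrable H) (hG : ∀ y, |G y| ≤ C)
    (x : ℝ) : |∫ y, H (x - y) * G y| ≤ C * ∫ y, |H y| := by
  have hint : Integrable fun y => C * |H (x - y)| := (hH.abs.comp_sub_left x).const_mul C
  have h := norm_integral_le_of_norm_le (f := fun y => H (x - y) * G y) hint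
    (Filter.Eventually.of_forall fun y => by
      rw [norm_mul, mul_comm]
      exact mul_le_mul_of_nonneg_right (hG y) (norm_nonneg _))
  rwa [integral_const_mul, integral_sub_left_eq_self (fun y => |H y|)] at h

/-- A function with bounded integrable derivative has a bounded Caputo derivative. -/
theorem exists_abs_caputo_le {α B : ℝ} {u : ℝ → ℝ} (hα : 0 < α) (hα1 : α < 1)
    (hu : Integrable (deriv u)) (hB : ∀ x, |deriv u x| ≤ B) :
    ∃ M : ℝ, ∀ x > 0, |caputo α u x| ≤ M := by
  have hB0 : 0 ≤ B := (abs_nonneg _).trans (hB 0)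
  set k : ℝ → ℝ := (Ioc (0 : ℝ) 1).indicator fun r => r ^ (-α)
  have hk : Integrable k := by
    rw [integrable_indicator_iff measurableSet_Ioc]
    exact (intervalIntegral.intervalIntegrable_rpow' (a := 0) (b := 1) (by linarith)).1
  have hk0 : ∀ r, 0 ≤ k r := fun r => indicator_nonneg (fun r hr => rpow_nonneg hr.1.le _) r
  refine ⟨|1 / Gamma (1 - α)| * ((∫ r, |deriv u r|) + B * ∫ r, k r), fun x hx => ?_⟩
  rw [caputo, abs_mul]
  refine mul_le_mul_of_nonneg_left ?_ (abs_nonneg _)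
  have hint : Integrable fun s => |deriv u s| + B * k (x - s) :=
    hu.abs.add ((hk.comp_sub_left x).const_mul B)
  have hbound : ∀ s ∈ Ioc 0 x,
      ‖deriv u s * (x - s) ^ (-α)‖ ≤ |deriv u s| + B * k (x - s) := by
    intro s hs
    have hxs : 0 ≤ x - s := sub_nonneg.2 hs.2
    rw [norm_mul, Real.norm_eq_abs, Real.norm_eq_abs, abs_of_nonneg (rpow_nonneg hxs _)]
    by_cases hr : x - s ∈ Ioc (0 : ℝ) 1
    · have h : k (x - s) = (x - s) ^ (-α) := indicator_of_mem hr _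
      rw [h]
      have := mul_le_mul_of_nonneg_right (hB s) (rpow_nonneg hxs (-α))
      linarith [abs_nonneg (deriv u s)]
    · have h : (x - s) ^ (-α) ≤ 1 := by
        rcases hxs.eq_or_lt with h0 | h0
        · rw [← h0, zero_rpow (by linarith)]
          exact zero_le_one
        · refine rpow_le_one_of_one_le_of_nonpos ?_ (by linarith)
          by_contra! hlt
          exact hr ⟨h0, hlt.le⟩
      have h1 := mul_le_mul_of_nonneg_left h (abs_nonneg (deriv u s))
      have h2 := mul_nonneg hB0 (hk0 (x - s))
      linarith
  have h := norm_integral_le_of_norm_le (μ := volume.restrict (Ioc 0 x)) hint.integrableOn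
    (by filter_upwards [ae_restrict_mem measurableSet_Ioc] with s hs using hbound s hs)
  rw [intervalIntegral.integral_of_le hx.le]
  refine h.trans ((setIntegral_le_integral hint (Filter.Eventually.of_forall fun s =>
    add_nonneg (abs_nonneg _) (mul_nonneg hB0 (hk0 _)))).trans (le_of_eq ?_))
  rw [integral_add hu.abs ((hk.comp_sub_left x).const_mul B), integral_const_mul,
    integral_sub_left_eq_self k]

theorem fundSol_of_pos {α t : ℝ} (ht : 0 < t) (x : ℝ) :
    fundSol α x t = a0 α * (t ^ (-(1 / (1 + α))) * PhiF α |t ^ (-(1 / (1 + α))) * x|) := by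
  rw [fundSol, if_pos ht, abs_mul, abs_of_pos (rpow_pos_of_pos ht _), mul_comm |x|, mul_assoc]

theorem continuous_fundSol {α : ℝ} (hα : 0 < α) (t : ℝ) : Continuous fun x => fundSol α x t := by
  by_cases ht : 0 < t
  · simp_rw [fundSol_of_pos ht]
    exact continuous_const.mul (continuous_const.mul
      ((continuous_PhiF hα).comp (continuous_const.mul continuous_id).abs))
  · simp only [fundSol, if_neg ht]
    exact continuous_const

theorem fundSol_eq_zero {α : ℝ} (h : a0 α = 0) (x t : ℝ) : fundSol α x t = 0 := by
  simp [fundSol, h]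

/-- Regularity of the convolution of the fundamental solution with compactly supported bounded
data. -/
theorem integrable_derivatives_of_convolution {α t C : ℝ} (hα : 0 < α) (hα1 : α < 1) (ht : 0 < t)
    {G : ℝ → ℝ} (hG : Integrable G) (hGc : HasCompactSupport G) (hGb : ∀ y, |G y| ≤ C)
    {w : ℝ → ℝ → ℝ} (hw : ∀ x t, w x t = ∫ y, fundSol α (x - y) t * G y) :
    Integrable (fun x => deriv (fun τ => w x τ) t) ∧
      (∃ M : ℝ, ∀ x > (0 : ℝ), |caputo α (fun y => w y t) x| ≤ M) ∧
      Integrable (fun x => deriv (fun ξ => w ξ t) x) := by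
  by_cases hint : IntegrableOn (PhiF α) (Ioi 0)
  swap
  · have ha : a0 α = 0 := by simp [a0, integral_undef hint]
    have hw0 : ∀ x t, w x t = 0 := fun x t => by simp [hw, fundSol_eq_zero ha]
    simp only [hw0, caputo, deriv_const', zero_mul, intervalIntegral.integral_zero, mul_zero,
      abs_zero]
    exact ⟨integrable_zero _ _ _, ⟨0, fun _ _ => le_rfl⟩, integrable_zero _ _ _⟩
  have hK : Integrable fun x => PhiF α |x| := integrable_comp_abs_of_integrableOn_Ioi hint
  have hxK' := integrable_mul_evenPhiDeriv hα hα1 hint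
  have hΦc := continuous_PhiF hα
  have hK'c := continuous_evenPhiDeriv hα
  have hK' : Integrable (evenPhiDeriv α) := integrable_of_integrable_mul_self hK'c hxK'
  set scale : ℝ → ℝ := fun τ => τ ^ (-(1 / (1 + α)))
  have hscale : 0 < scale t := rpow_pos_of_pos ht _
  have hwU : ∀ x, ∀ τ > 0, w x τ =
      a0 α * ∫ y, scale τ * PhiF α |scale τ * (x - y)| * G y := fun x τ hτ => by
    rw [hw, ← integral_const_mul]
    refine integral_congr_ae (Filter.Eventually.of_forall fun y => ?_)
    simp only [fundSol_of_pos hτ, scale, mul_assoc]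
  have hspace : ∀ x, HasDerivAt (fun ξ => w ξ t)
      (a0 α * ∫ y, scale t * (evenPhiDeriv α (scale t * (x - y)) * scale t) * G y) x := by
    intro x
    rw [show (fun ξ => w ξ t) = _ from funext fun ξ => hwU ξ t ht]
    refine HasDerivAt.const_mul _ (hasDerivAt_integral_mul_of_hasCompactSupport
      (f := fun ξ y => scale t * PhiF α |scale t * (ξ - y)|)
      (f' := fun ξ y => scale t * (evenPhiDeriv α (scale t * (ξ - y)) * scale t))
      (fun ξ y => ?_) (fun ξ => by fun_prop) (by fun_prop) hG hGc x)
    have hlin : HasDerivAt (fun ξ => scale t * (ξ - y)) (scale t) ξ := by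
      simpa using ((hasDerivAt_id ξ).sub_const y).const_mul (scale t)
    exact ((hasDerivAt_PhiF_abs hα _).comp ξ hlin).const_mul _
  have htime : ∀ x, HasDerivAt (fun τ => w x τ)
      (a0 α * ((∫ y, (PhiF α |scale t * (x - y)| +
        scale t * (x - y) * evenPhiDeriv α (scale t * (x - y))) * G y) * deriv scale t)) t := by
    intro x
    have hU := hasDerivAt_integral_mul_of_hasCompactSupport
      (f := fun l y => l * PhiF α |l * (x - y)|)
      (f' := fun l y => PhiF α |l * (x - y)| + l * (x - y) * evenPhiDeriv α (l * (x - y)))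
      (fun l y => ?_) (fun l => by fun_prop) (by fun_prop) hG hGc (scale t)
    · have hs : HasDerivAt scale (deriv scale t) t :=
        (hasDerivAt_rpow_const (Or.inl ht.ne')).differentiableAt.hasDerivAt
      refine ((hU.comp t hs).const_mul (a0 α)).congr_of_eventuallyEq ?_
      filter_upwards [lt_mem_nhds ht] with τ hτ using hwU x τ hτ
    · have hlin : HasDerivAt (fun l => l * (x - y)) (x - y) l := by
        simpa using (hasDerivAt_id l).mul_const (x - y)
      refine ((hasDerivAt_id l).mul ((hasDerivAt_PhiF_abs hα _).comp l hlin)).congr_deriv ?_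
      simp only [id, Function.comp_apply]
      ring
  have hHspace : Integrable fun z => scale t * (evenPhiDeriv α (scale t * z) * scale t) :=
    ((hK'.comp_mul_left' hscale.ne').mul_const _).const_mul _
  have hHtime : Integrable fun z =>
      PhiF α |scale t * z| + scale t * z * evenPhiDeriv α (scale t * z) :=
    (hK.add hxK').comp_mul_left' hscale.ne'
  have hderiv : deriv (fun ξ => w ξ t) = fun x =>
      a0 α * ∫ y, scale t * (evenPhiDeriv α (scale t * (x - y)) * scale t) * G y :=
    funext fun x => (hspace x).deriv
  have hspaceInt : Integrable (deriv fun ξ => w ξ t) := by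
    rw [hderiv]
    exact (integrable_integral_sub_mul hHspace hG).const_mul _
  refine ⟨?_, ?_, hspaceInt⟩
  · rw [show (fun x => deriv (fun τ => w x τ) t) = _ from funext fun x => (htime x).deriv]
    exact ((integrable_integral_sub_mul hHtime hG).mul_const _).const_mul _
  · refine exists_abs_caputo_le (B := |a0 α| *
      (C * ∫ z, |scale t * (evenPhiDeriv α (scale t * z) * scale t)|)) hα hα1 hspaceInt fun x => ?_
    rw [hderiv, abs_mul]
    exact mul_le_mul_of_nonneg_left (abs_integral_sub_mul_le hHspace hGb x) (abs_nonneg _)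

/-- Half-line convolutions with reflected kernels are convolutions with extended data. -/
theorem integral_Ioi_add_reflect_eq {E g : ℝ → ℝ} (hE : Continuous E)
    (hg : IntegrableOn g (Ioi 0)) (hgc : HasCompactSupport g) (σ x : ℝ) :
    ∫ y in Ioi (0 : ℝ), (E (x - y) + σ * E (x + y)) * g y =
      ∫ y, E (x - y) * ((Ioi 0).indicator g y + σ * (Ioi 0).indicator g (-y)) := by
  set G := (Ioi (0 : ℝ)).indicator g
  have hG : Integrable G := (integrable_indicator_iff measurableSet_Ioi).2 hg
  have hGc : HasCompactSupport G := hgc.mono (by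
    intro y hy hgy
    exact hy (by simp [G, indicator, hgy]))
  have h1 : Integrable fun y => E (x - y) * G y :=
    (hE.comp (continuous_const.sub continuous_id)).integrable_mul_of_hasCompactSupport hG hGc
  have h2 : Integrable fun y => E (x + y) * G y :=
    (hE.comp (continuous_const.add continuous_id)).integrable_mul_of_hasCompactSupport hG hGc
  have h3 : Integrable fun y => E (x - y) * G (-y) := by
    simpa [sub_eq_add_neg] using h2.comp_neg
  have h4 : ∫ y, E (x - y) * G (-y) = ∫ y, E (x + y) * G y := by
    rw [← integral_neg_eq_self]
    simp
  rw [← integral_indicator measurableSet_Ioi]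
  calc _ = ∫ y, E (x - y) * G y + σ * (E (x + y) * G y) := by
        refine integral_congr_ae (Filter.Eventually.of_forall fun y => ?_)
        by_cases hy : y ∈ Ioi (0 : ℝ)
        · simp only [indicator_of_mem hy, G]
          ring
        · simp only [indicator_of_notMem hy, G, mul_zero, add_zero]
    _ = ∫ y, E (x - y) * G y + σ * (E (x - y) * G (-y)) := by
        rw [integral_add h1 (h2.const_mul σ), integral_add h1 (h3.const_mul σ),
          integral_const_mul, integral_const_mul, h4]
    _ = _ := by
        congr 1 with y
        ring

theorem derivative_integrability_of_reflect {α t σ : ℝ} (hα : 0 < α) (hα1 : α < 1) (ht : 0 < t)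
    {g : ℝ → ℝ} (hgc : ContinuousOn g (Ici 0)) (hgint : IntegrableOn g (Ioi 0))
    (hgsupp : HasCompactSupport g) {w : ℝ → ℝ → ℝ}
    (hw : ∀ x t, w x t =
      ∫ y in Ioi (0 : ℝ), (fundSol α (x - y) t + σ * fundSol α (x + y) t) * g y) :
    IntegrableOn (fun x => deriv (fun τ => w x τ) t) (Ioi 0) ∧
      (∃ M : ℝ, ∀ x > (0 : ℝ), |caputo α (fun y => w y t) x| ≤ M) ∧
      IntegrableOn (fun x => deriv (fun ξ => w ξ t) x) (Ioi 0) := by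
  set G := (Ioi (0 : ℝ)).indicator g
  have hG : Integrable G := (integrable_indicator_iff measurableSet_Ioi).2 hgint
  have hGc : HasCompactSupport G := hgsupp.mono (by
    intro y hy hgy
    exact hy (by simp [G, indicator, hgy]))
  have hGc' : HasCompactSupport fun y => G (-y) := hGc.comp_homeomorph (Homeomorph.neg ℝ)
  obtain ⟨C, hC⟩ := (hgsupp.isCompact.inter_right isClosed_Ici).exists_bound_of_continuousOn
    (hgc.mono inter_subset_right)
  have hGb : ∀ y, |G y| ≤ |C| := by
    intro y
    by_cases hy : y ∈ Ioi (0 : ℝ) ∧ y ∈ tsupport g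
    · simp only [G, indicator_of_mem hy.1]
      exact (hC y ⟨hy.2, mem_Ici.2 (le_of_lt hy.1)⟩).trans (le_abs_self C)
    · have : G y = 0 := by
        rcases not_and_or.1 hy with h | h
        · exact indicator_of_notMem h g
        · simp [G, indicator, image_eq_zero_of_notMem_tsupport h]
      simp [this]
  obtain ⟨h1, h2, h3⟩ := integrable_derivatives_of_convolution (w := w) hα hα1 ht
    (G := fun y => G y + σ * G (-y)) (C := |C| + |σ| * |C|) (hG.add (hG.comp_neg.const_mul σ))
    (hGc.add (hGc'.mul_left))
    (fun y => (abs_add_le _ _).trans (by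
      rw [abs_mul]
      exact add_le_add (hGb y) (mul_le_mul_of_nonneg_left (hGb (-y)) (abs_nonneg σ))))
    (fun x t => by rw [hw, integral_Ioi_add_reflect_eq (continuous_fundSol hα t) hgint hgsupp])
  exact ⟨h1.integrableOn, h2, h3.integrableOn⟩

/-- integrability of the derivatives of the convolution solutions
`w₁`, `w₂` for `g ∈ W^{1,1}(0,∞)` with compact support and `g(0) = 0`:
for each `t > 0`, (1) `∂wᵢ/∂t(·,t) ∈ L¹(0,∞)`, (2) `D^α_x wᵢ(·,t) ∈ L^∞(0,∞)`,
(3) `∂wᵢ/∂x(·,t) ∈ L¹(0,∞)`. The membership `g ∈ W^{1,1}` is encoded through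
continuity, integrability of `g` and `deriv g`, and the fundamental theorem of
calculus. -/
theorem derivative_integrability
    (α : ℝ) (hα : α ∈ Set.Ioo (0:ℝ) 1)
    (g : ℝ → ℝ)
    (hgc : ContinuousOn g (Set.Ici 0))
    (hgint : IntegrableOn g (Set.Ioi 0))
    (hg'int : IntegrableOn (deriv g) (Set.Ioi 0))
    (hgtc : ∀ x ≥ (0:ℝ), g x = g 0 + ∫ s in (0:ℝ)..x, deriv g s)
    (hgsupp : HasCompactSupport g)
    (hg0 : g 0 = 0)
    (w₁ w₂ : ℝ → ℝ → ℝ)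
    (hw₁ : ∀ x t, w₁ x t =
      ∫ y in Set.Ioi (0:ℝ), (fundSol α (x - y) t - fundSol α (x + y) t) * g y)
    (hw₂ : ∀ x t, w₂ x t =
      ∫ y in Set.Ioi (0:ℝ), (fundSol α (x - y) t + fundSol α (x + y) t) * g y) :
    ∀ t > (0:ℝ), ∀ w ∈ ({w₁, w₂} : Set (ℝ → ℝ → ℝ)),
      IntegrableOn (fun x => deriv (fun τ => w x τ) t) (Set.Ioi 0) ∧
      (∃ M : ℝ, ∀ x > (0:ℝ), |caputo α (fun y => w y t) x| ≤ M) ∧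
      IntegrableOn (fun x => deriv (fun ξ => w ξ t) x) (Set.Ioi 0) := by
  intro t ht w hw
  rcases hw with rfl | rfl
  · exact derivative_integrability_of_reflect (σ := -1) hα.1 hα.2 ht hgc hgint hgsupp
      fun x t => by simp only [hw₁, neg_one_mul, sub_eq_add_neg]
  · exact derivative_integrability_of_reflect (σ := 1) hα.1 hα.2 ht hgc hgint hgsupp
      fun x t => by simp only [hw₂, one_mul]
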